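/- arXiv:1404.2949 — 2 statements merged into one kernel-verified Lean document; each statement's English description precedes it below -/
import Mathlib

section
/- Let f : [0,1]^d → ℝ be smooth on simplices, let x ∈ (0,1)^d be an interior point, let v ∈ {0,1}^d and set α := α(d(x),v). Then lim_{n→∞} (2n)^α Δ̃_n^v f(x) = D_α^v f(x), i.e. the rescaled lattice approximations of the derivative converge to the generalised differential (which exists at x). -/
open MeasureTheory Filter Set

namespace Paper

variable {d : ℕ}

/-- The closed unit cube `[0,1]^d`. -/
def cubeIcc (d : ℕ) : Set (Fin d → ℝ) := Set.Icc 0 1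

/-- The half-open cube `[0,1)^d`. -/
def cubeIco (d : ℕ) : Set (Fin d → ℝ) := Set.univ.pi fun _ => Set.Ico (0:ℝ) 1

/-- The open cube `(0,1)^d`. -/
def cubeIoo (d : ℕ) : Set (Fin d → ℝ) := Set.univ.pi fun _ => Set.Ioo (0:ℝ) 1

/-- The sign `(−1)^{⟨v,w⟩}` for `v, w ∈ {0,1}^d`. -/
def sgn (v w : Fin d → Bool) : ℝ :=
  (-1) ^ (Finset.univ.filter fun i => v i = true ∧ w i = true).card

/-- `|v|`, the number of nonzero entries of `v ∈ {0,1}^d`. -/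
def wt (v : Fin d → Bool) : ℕ := (Finset.univ.filter fun i => v i = true).card

/-- The vector `h^w = h·((−1)^{w_1},…,(−1)^{w_d})`. -/
def shiftVec (h : ℝ) (w : Fin d → Bool) : Fin d → ℝ := fun i => if w i then -h else h

/-- The discrete Fourier difference `Δ_h^v f (x) = 2^{-d} ∑_w (−1)^{⟨v,w⟩} f(x + h^w)`. -/
noncomputable def dfourier (f : (Fin d → ℝ) → ℝ) (v : Fin d → Bool) (h : ℝ)
    (x : Fin d → ℝ) : ℝ :=
  (1 / 2 ^ d) * ∑ w : Fin d → Bool, sgn v w * f (x + shiftVec h w)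

/-- The partial derivative in direction `i`. -/
noncomputable def pderivI (i : Fin d) (f : (Fin d → ℝ) → ℝ) : (Fin d → ℝ) → ℝ :=
  fun x => fderiv ℝ f x (Pi.single i 1)

/-- The mixed partial derivative `D^v f = (∂/∂x_1)^{v_1} ⋯ (∂/∂x_d)^{v_d} f`. -/
noncomputable def Dmixed (v : Fin d → Bool) (f : (Fin d → ℝ) → ℝ) : (Fin d → ℝ) → ℝ :=
  (List.finRange d).foldr (fun i g => cond (v i) (pderivI i g) g) f

/-- The Kuhn simplex `S_σ = {x ∈ [0,1]^d : x_{σ(1)} ≤ … ≤ x_{σ(d)}}`. -/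
def KuhnSimplex (σ : Equiv.Perm (Fin d)) : Set (Fin d → ℝ) :=
  {x | x ∈ cubeIcc d ∧ ∀ i j : Fin d, i ≤ j → x (σ i) ≤ x (σ j)}

/-- A continuous function on the cube is smooth on simplices if its restriction to each
Kuhn simplex extends to a `C^∞` function on an open neighbourhood of the simplex. -/
def SmoothOnSimplices (f : (Fin d → ℝ) → ℝ) : Prop :=
  ContinuousOn f (cubeIcc d) ∧
  ∀ σ : Equiv.Perm (Fin d), ∃ (U : Set (Fin d → ℝ)) (g : (Fin d → ℝ) → ℝ),
    IsOpen U ∧ KuhnSimplex σ ⊆ U ∧ ContDiffOn ℝ (⊤ : ℕ∞) g U ∧ Set.EqOn f g (KuhnSimplex σ)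

/-- The centre `x̃^{(n)}` of the lattice cell of side `1/n` containing `x`. -/
noncomputable def latticeCenter (n : ℕ) (x : Fin d → ℝ) : Fin d → ℝ :=
  fun i => (⌊(n : ℝ) * x i⌋ : ℝ) / n + 1 / (2 * n)

/-- The `n`-th lattice approximation `Δ̃_n^v f (x) = Δ_{1/(2n)}^v f (x̃^{(n)})`. -/
noncomputable def latticeDelta (n : ℕ) (f : (Fin d → ℝ) → ℝ) (v : Fin d → Bool)
    (x : Fin d → ℝ) : ℝ :=
  dfourier f v (1 / (2 * n)) (latticeCenter n x)

/-- `f` has generalised differential `L` at `x` to `v` in degree `α`. -/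
def HasGenDeriv (f : (Fin d → ℝ) → ℝ) (v : Fin d → Bool) (α : ℕ)
    (x : Fin d → ℝ) (L : ℝ) : Prop :=
  Tendsto (fun h : ℝ => (1 / h ^ α) * dfourier f v h x) (nhdsWithin 0 (Set.Ioi 0)) (nhds L)

/-- The generalised differential `D_α^v f(x)` (the value of the limit when it exists). -/
noncomputable def genDeriv (f : (Fin d → ℝ) → ℝ) (v : Fin d → Bool) (α : ℕ)
    (x : Fin d → ℝ) : ℝ :=
  limUnder (nhdsWithin 0 (Set.Ioi 0)) fun h : ℝ => (1 / h ^ α) * dfourier f v h x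

/-- `x` has coincidence partition given by the fibres of the surjection `p`,
i.e. `d(x) = 𝒫` where `𝒫` is the partition of `{1,…,d}` into the fibres of `p`. -/
def CoincWith (x : Fin d → ℝ) {k : ℕ} (p : Fin d → Fin k) : Prop :=
  ∀ i j, x i = x j ↔ p i = p j

/-- The generalised diagonal `𝒟_𝒫 = {x ∈ (0,1)^d : d(x) = 𝒫}`. -/
def diagP {k : ℕ} (p : Fin d → Fin k) : Set (Fin d → ℝ) :=
  {x | x ∈ cubeIoo d ∧ CoincWith x p}

/-- `α(𝒫,v)`: the number of blocks of `𝒫` containing an index `a` with `v_a = 1`. -/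
def alphaP {k : ℕ} (p : Fin d → Fin k) (v : Fin d → Bool) : ℕ :=
  ((Finset.univ.filter fun i => v i = true).image p).card

/-- sign of a Boolean -/
def sg (b : Bool) : ℝ := if b then -1 else 1

/-- moved point: block-wise step sizes `t`. -/
def mv (x c : Fin d → ℝ) (t : ℝ → ℝ) (w : Fin d → Bool) : Fin d → ℝ :=
  fun i => c i + t (x i) * sg (w i)

/-- block direction -/
noncomputable def dirv (x : Fin d → ℝ) (b : ℝ) (w : Fin d → Bool) : Fin d → ℝ :=
  fun i => if x i = b then sg (w i) else 0

/-- iterated directional derivatives -/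
noncomputable def Dl (x : Fin d → ℝ) (g : (Fin d → Bool) → (Fin d → ℝ) → ℝ) :
    List ℝ → (Fin d → Bool) → (Fin d → ℝ) → ℝ
  | [], w => g w
  | b :: l, w => fun y => fderiv ℝ (Dl x g l w) y (dirv x b w)

/-- signed sum -/
noncomputable def GG (x : Fin d → ℝ) (g : (Fin d → Bool) → (Fin d → ℝ) → ℝ) (v : Fin d → Bool)
    (l : List ℝ) (c : Fin d → ℝ) (t : ℝ → ℝ) : ℝ :=
  ∑ w : Fin d → Bool, sgn v w * Dl x g l w (mv x c t w)

lemma abs_sg (b : Bool) : |sg b| = 1 := by cases b <;> simp [sg]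

lemma Dl_smooth (x : Fin d → ℝ) (g : (Fin d → Bool) → (Fin d → ℝ) → ℝ) (U : Set (Fin d → ℝ))
    (hU : IsOpen U) (hg : ∀ w, ContDiffOn ℝ (⊤ : ℕ∞) (g w) U) (l : List ℝ) (w : Fin d → Bool) :
    ContDiffOn ℝ (⊤ : ℕ∞) (Dl x g l w) U := by
  induction l with
  | nil => exact hg w
  | cons b l ih =>
    exact (ih.fderiv_of_isOpen hU (m := ((⊤ : ℕ∞) : WithTop ℕ∞)) (by simp)).clm_apply
      contDiffOn_const

lemma mv_update (x c : Fin d → ℝ) (t : ℝ → ℝ) (w : Fin d → Bool) (b τ : ℝ) :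
    mv x c (Function.update t b τ) w = mv x c t w + (τ - t b) • dirv x b w := by
  ext i
  simp only [mv, dirv, Pi.add_apply, Pi.smul_apply, smul_eq_mul, Function.update_apply]
  split_ifs with h
  · rw [h]; ring
  · ring

lemma mv_mem (x c : Fin d → ℝ) (t : ℝ → ℝ) (w : Fin d → Bool) (ε : ℝ) (hε : 0 < ε)
    (hc : ‖c - x‖ < ε) (ht : ∀ b, 0 ≤ t b ∧ t b < ε) : mv x c t w ∈ Metric.ball x (2 * ε) := by
  rw [mem_ball_iff_norm, pi_norm_lt_iff (by linarith)]
  intro i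
  have h1 := (pi_norm_lt_iff hε).1 hc i
  have h2 : |t (x i) * sg (w i)| < ε := by
    rw [abs_mul, abs_sg, mul_one, abs_of_nonneg (ht _).1]; exact (ht _).2
  have : (mv x c t w - x) i = (c - x) i + t (x i) * sg (w i) := by
    simp only [mv, Pi.sub_apply]; ring
  rw [this]
  refine (norm_add_le _ _).trans_lt ?_
  rw [Real.norm_eq_abs (t (x i) * sg (w i))]
  linarith

lemma GG_deriv (x : Fin d → ℝ) (g : (Fin d → Bool) → (Fin d → ℝ) → ℝ) (v : Fin d → Bool)
    (ε : ℝ) (hε : 0 < ε)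
    (hg : ∀ w, ContDiffOn ℝ (⊤ : ℕ∞) (g w) (Metric.ball x (2 * ε))) (l : List ℝ)
    (c : Fin d → ℝ) (hc : ‖c - x‖ < ε) (t : ℝ → ℝ) (ht : ∀ b, 0 ≤ t b ∧ t b < ε)
    (b τ : ℝ) (hτ : 0 ≤ τ ∧ τ < ε) :
    HasDerivAt (fun τ => GG x g v l c (Function.update t b τ))
      (GG x g v (b :: l) c (Function.update t b τ)) τ := by
  unfold GG
  refine HasDerivAt.fun_sum fun w _ => HasDerivAt.const_mul _ ?_
  have hmem : mv x c (Function.update t b τ) w ∈ Metric.ball x (2 * ε) := by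
    apply mv_mem x c _ w ε hε hc
    intro b'
    rw [Function.update_apply]
    split_ifs
    · exact hτ
    · exact ht b'
  have h1 : HasFDerivAt (Dl x g l w) (fderiv ℝ (Dl x g l w) (mv x c (Function.update t b τ) w))
      (mv x c (Function.update t b τ) w) :=
    (((Dl_smooth x g _ Metric.isOpen_ball hg l w).contDiffAt
      (Metric.isOpen_ball.mem_nhds hmem)).differentiableAt (by simp)).hasFDerivAt
  have h2 : HasDerivAt (fun τ => mv x c (Function.update t b τ) w) (dirv x b w) τ := by
    simp only [mv_update]
    simpa using (((hasDerivAt_id τ).sub_const (t b)).smul_const (dirv x b w)).const_add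
      (mv x c t w)
  exact h1.comp_hasDerivAt τ h2

lemma sgn_flip (v w : Fin d → Bool) (a : Fin d) (ha : v a = true) :
    sgn v (Function.update w a (!w a)) = - sgn v w := by
  have key : ∀ w : Fin d → Bool, sgn v w = ∏ i, (if v i = true ∧ w i = true then (-1 : ℝ) else 1) := by
    intro w
    rw [sgn, Finset.prod_ite]; simp
  rw [key, key, ← Finset.mul_prod_erase _ _ (Finset.mem_univ a),
    ← Finset.mul_prod_erase Finset.univ (fun i => if v i = true ∧ w i = true then (-1 : ℝ) else 1)
      (Finset.mem_univ a), ← neg_mul]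
  congr 1
  · cases h : w a <;> simp [ha, h]
  · apply Finset.prod_congr rfl
    intro i hi
    rw [Function.update_of_ne (Finset.ne_of_mem_erase hi)]

lemma sum_zero (f : (Fin d → ℝ) → ℝ) (x c : Fin d → ℝ) (v : Fin d → Bool) (t : ℝ → ℝ)
    (a : Fin d) (ha : v a = true) (hta : t (x a) = 0) :
    ∑ w : Fin d → Bool, sgn v w * f (mv x c t w) = 0 := by
  have hinv : Function.Involutive (fun w : Fin d → Bool => Function.update w a (!w a)) := by
    intro w; simp
  have h := Equiv.sum_comp hinv.toPerm (fun w : Fin d → Bool => sgn v w * f (mv x c t w))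
  have h2 : ∀ w : Fin d → Bool, sgn v ((hinv.toPerm : Equiv.Perm (Fin d → Bool)) w) *
      f (mv x c t ((hinv.toPerm : Equiv.Perm (Fin d → Bool)) w))
      = - (sgn v w * f (mv x c t w)) := by
    intro w
    have e : mv x c t (Function.update w a (!w a)) = mv x c t w := by
      ext i
      by_cases hi : i = a
      · subst hi; simp [mv, hta]
      · simp [mv, hi]
    simp only [Function.Involutive.coe_toPerm, sgn_flip v w a ha, e, neg_mul]
  simp only [h2, Finset.sum_neg_distrib] at h
  linarith

lemma GG_zero (f : (Fin d → ℝ) → ℝ) (x : Fin d → ℝ) (g : (Fin d → Bool) → (Fin d → ℝ) → ℝ)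
    (v : Fin d → Bool) (ε : ℝ) (hε : 0 < ε)
    (hg : ∀ w, ContDiffOn ℝ (⊤ : ℕ∞) (g w) (Metric.ball x (2 * ε)))
    (c : Fin d → ℝ) (hc : ‖c - x‖ < ε)
    (hfg : ∀ w t, (∀ b, 0 ≤ t b ∧ t b < ε) → f (mv x c t w) = g w (mv x c t w))
    (a : Fin d) (ha : v a = true) (l : List ℝ) (hl : l.Nodup) (hal : x a ∉ l) :
    ∀ t : ℝ → ℝ, (∀ b, 0 ≤ t b ∧ t b < ε) → (∀ b ∈ l, 0 < t b) → t (x a) = 0 →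
      GG x g v l c t = 0 := by
  induction l with
  | nil =>
    intro t ht _ h0
    rw [← sum_zero f x c v t a ha h0]
    refine Finset.sum_congr rfl fun w _ => ?_
    rw [hfg w t ht]; rfl
  | cons b l ih =>
    intro t ht hp h0
    have hd := GG_deriv x g v ε hε hg l c hc t ht b (t b) (ht b)
    rw [Function.update_eq_self] at hd
    rw [List.nodup_cons] at hl
    rw [List.mem_cons, not_or] at hal
    have hz : (fun τ => GG x g v l c (Function.update t b τ)) =ᶠ[nhds (t b)] fun _ => 0 := by
      filter_upwards [Ioo_mem_nhds (hp b (by simp)) (ht b).2] with τ hτ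
      apply ih hl.2 hal.2
      · intro b'
        rw [Function.update_apply]
        split_ifs
        · exact ⟨hτ.1.le, hτ.2⟩
        · exact ht b'
      · intro b' hb'
        rw [Function.update_apply]
        split_ifs
        · exact hτ.1
        · exact hp b' (by simp [hb'])
      · rw [Function.update_of_ne hal.1, h0]
    exact hd.unique ((hasDerivAt_const (t b) (0:ℝ)).congr_of_eventuallyEq hz)

lemma GG_mvt (f : (Fin d → ℝ) → ℝ) (x : Fin d → ℝ) (g : (Fin d → Bool) → (Fin d → ℝ) → ℝ)
    (v : Fin d → Bool) (ε : ℝ) (hε : 0 < ε)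
    (hg : ∀ w, ContDiffOn ℝ (⊤ : ℕ∞) (g w) (Metric.ball x (2 * ε)))
    (c : Fin d → ℝ) (hc : ‖c - x‖ < ε)
    (hfg : ∀ w t, (∀ b, 0 ≤ t b ∧ t b < ε) → f (mv x c t w) = g w (mv x c t w))
    (h : ℝ) (h0 : 0 < h) (hh : h < ε)
    (l : List ℝ) (hl : l.Nodup) (hlv : ∀ b ∈ l, ∃ a, v a = true ∧ x a = b) :
    ∃ t : ℝ → ℝ, (∀ b, 0 < t b ∧ t b ≤ h) ∧ (∀ b ∉ l, t b = h) ∧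
      GG x g v [] c (fun _ => h) = h ^ l.length * GG x g v l c t := by
  induction l with
  | nil => exact ⟨fun _ => h, fun _ => ⟨h0, le_rfl⟩, fun _ _ => rfl, by simp⟩
  | cons b l ih =>
    rw [List.nodup_cons] at hl
    obtain ⟨t, ht, hth, e⟩ := ih hl.2 fun b hb => hlv b (by simp [hb])
    have ht' : ∀ b, 0 ≤ t b ∧ t b < ε := fun b => ⟨(ht b).1.le, (ht b).2.trans_lt hh⟩
    obtain ⟨a, ha, rfl⟩ := hlv b (by simp)
    have hd : ∀ τ ∈ Icc 0 h, HasDerivAt (fun τ => GG x g v l c (Function.update t (x a) τ))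
      (GG x g v (x a :: l) c (Function.update t (x a) τ)) τ := fun τ hτ =>
        GG_deriv x g v ε hε hg l c hc t ht' (x a) τ ⟨hτ.1, hτ.2.trans_lt hh⟩
    obtain ⟨τ, hτ, hE⟩ := exists_hasDerivAt_eq_slope
      (fun τ => GG x g v l c (Function.update t (x a) τ)) _ h0
      (fun τ hτ => (hd τ hτ).continuousAt.continuousWithinAt)
      (fun τ hτ => hd τ ⟨hτ.1.le, hτ.2.le⟩)
    have hz : GG x g v l c (Function.update t (x a) 0) = 0 := by
      apply GG_zero f x g v ε hε hg c hc hfg a ha l hl.2 hl.1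
      · intro b'
        rw [Function.update_apply]
        split_ifs
        · exact ⟨le_rfl, hε⟩
        · exact ht' b'
      · intro b' hb'
        rw [Function.update_of_ne (by rintro rfl; exact hl.1 hb')]
        exact (ht b').1
      · simp
    have hs : Function.update t (x a) h = t := by
      conv_lhs => rw [← hth _ hl.1]
      simp
    refine ⟨Function.update t (x a) τ, ?_, ?_, ?_⟩
    · intro b'
      rw [Function.update_apply]
      split_ifs
      · exact ⟨hτ.1, hτ.2.le⟩
      · exact ht b'
    · intro b' hb'
      rw [List.mem_cons, not_or] at hb'
      rw [Function.update_of_ne hb'.1, hth _ hb'.2]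
    · rw [hE, hz, hs, e, List.length_cons, pow_succ, sub_zero, sub_zero]
      field_simp

lemma main_lim (f : (Fin d → ℝ) → ℝ) (hf : SmoothOnSimplices f)
    (x : Fin d → ℝ) (hx : x ∈ cubeIoo d) (v : Fin d → Bool) :
    ∃ D : ℝ, ∀ δ > 0, ∃ ε > 0, ∀ (c : Fin d → ℝ) (h : ℝ), 0 < h → h < ε → ‖c - x‖ < ε →
      (∀ i j, x i = x j → c i = c j) →
      |(1 / h ^ (Set.ncard (x '' {i | v i = true}))) * dfourier f v h c - D| < δ := by
  classical
  let σ : (Fin d → Bool) → Equiv.Perm (Fin d) := fun w =>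
    Tuple.sort (fun i => toLex (x i, sg (w i)))
  have hσ : ∀ w i j, i ≤ j → x (σ w i) < x (σ w j) ∨
      (x (σ w i) = x (σ w j) ∧ sg (w (σ w i)) ≤ sg (w (σ w j))) := by
    intro w i j hij
    have := Tuple.monotone_sort (fun i => toLex (x i, sg (w i))) hij
    simpa [Prod.Lex.toLex_le_toLex] using this
  choose U g hUo hUs hgs hfg using hf.2
  have hxIcc : ∀ y ∈ cubeIoo d, y ∈ cubeIcc d := by
    intro y hy
    simp only [cubeIoo, Set.mem_pi, Set.mem_univ, true_implies] at hy
    exact ⟨fun i => (hy i).1.le, fun i => (hy i).2.le⟩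
  have hxU : ∀ w, x ∈ U (σ w) := by
    intro w
    apply hUs
    refine ⟨hxIcc x hx, fun i j hij => ?_⟩
    rcases hσ w i j hij with h | h
    · exact h.le
    · exact h.1.le
  let V : Set (Fin d → ℝ) := (cubeIoo d ∩ ⋂ i, ⋂ j, {y | x i < x j → y i < y j}) ∩ ⋂ w, U (σ w)
  have hVo : V ∈ nhds x := by
    refine inter_mem (inter_mem ?_ ?_) ?_
    · exact (isOpen_set_pi Set.finite_univ (fun _ _ => isOpen_Ioo)).mem_nhds hx
    · refine Filter.iInter_mem.2 fun i => Filter.iInter_mem.2 fun j => ?_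
      by_cases hij : x i < x j
      · simp only [hij, true_implies]
        exact (isOpen_lt (continuous_apply i) (continuous_apply j)).mem_nhds hij
      · simp [hij]
    · exact Filter.iInter_mem.2 fun w => (hUo _).mem_nhds (hxU w)
  obtain ⟨r, hr, hrV⟩ := Metric.mem_nhds_iff.1 hVo
  let B : Set (Fin d → ℝ) := Metric.ball x r
  let g' : (Fin d → Bool) → (Fin d → ℝ) → ℝ := fun w => g (σ w)
  have hg' : ∀ w, ContDiffOn ℝ (⊤ : ℕ∞) (g' w) (Metric.ball x r) := fun w =>
    (hgs (σ w)).mono fun y hy => Set.mem_iInter.1 (hrV hy).2 w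
  let S : Finset ℝ := (Finset.univ.filter fun i => v i = true).image x
  have hS : Set.ncard (x '' {i | v i = true}) = S.toList.length := by
    rw [Finset.length_toList, ← Set.ncard_coe_finset]
    congr 1
    simp [S]
  rw [hS]
  set l := S.toList with hldef
  have hl : l.Nodup := S.nodup_toList
  have hlv : ∀ b ∈ l, ∃ a, v a = true ∧ x a = b := by
    intro b hb
    simpa [l, S] using hb
  refine ⟨(1 / 2 ^ d) * ∑ w : Fin d → Bool, sgn v w * Dl x g' l w x, fun δ hδ => ?_⟩
  -- continuity
  have hcont : ∀ w, ContinuousAt (Dl x g' l w) x := fun w =>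
    (Dl_smooth x g' _ Metric.isOpen_ball hg' l w).continuousOn.continuousAt
      (Metric.ball_mem_nhds x hr)
  have hη : ∀ᶠ y : (Fin d → Bool) → (Fin d → ℝ) in nhds (fun _ => x),
      |(1 / 2 ^ d) * ∑ w : Fin d → Bool, sgn v w * Dl x g' l w (y w) -
        (1 / 2 ^ d) * ∑ w : Fin d → Bool, sgn v w * Dl x g' l w x| < δ := by
    have : ContinuousAt (fun y : (Fin d → Bool) → (Fin d → ℝ) =>
        (1 / 2 ^ d) * ∑ w : Fin d → Bool, sgn v w * Dl x g' l w (y w)) (fun _ => x) := by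
      refine ContinuousAt.mul continuousAt_const ?_
      refine tendsto_finsetSum _ fun w _ => ?_
      refine Tendsto.mul tendsto_const_nhds ?_
      exact Tendsto.comp (hcont w) (continuous_apply w).continuousAt
    exact (Metric.tendsto_nhds.1 this δ hδ)
  obtain ⟨ρ, hρ, hρη⟩ := Metric.eventually_nhds_iff.1 hη
  set ε := min r ρ / 2 with hεd
  have hε : 0 < ε := by positivity
  have hεr : 2 * ε ≤ r := by rw [hεd]; linarith [min_le_left r ρ]
  have hερ : 2 * ε ≤ ρ := by rw [hεd]; linarith [min_le_right r ρ]
  refine ⟨ε, hε, fun c h h0 hh hc hcb => ?_⟩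
  have hfg' : ∀ w t, (∀ b, 0 ≤ t b ∧ t b < ε) → f (mv x c t w) = g' w (mv x c t w) := by
    intro w t ht
    apply hfg (σ w)
    have hm := hrV (Metric.ball_subset_ball hεr (mv_mem x c t w ε hε hc ht))
    refine ⟨hxIcc _ hm.1.1, fun i j hij => ?_⟩
    rcases hσ w i j hij with h | h
    · exact (Set.mem_iInter.1 (Set.mem_iInter.1 hm.1.2 (σ w i)) (σ w j) h).le
    · simp only [mv]
      rw [hcb _ _ h.1, h.1]
      have := mul_le_mul_of_nonneg_left h.2 (ht (x (σ w j))).1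
      linarith
  obtain ⟨t, ht, -, he⟩ := GG_mvt f x g' v ε hε
    (fun w => (hg' w).mono (Metric.ball_subset_ball hεr)) c hc hfg' h h0 hh l hl hlv
  have hdf : dfourier f v h c = (1 / 2 ^ d) * GG x g' v [] c (fun _ => h) := by
    unfold dfourier GG
    congr 1
    refine Finset.sum_congr rfl fun w _ => ?_
    have : c + shiftVec h w = mv x c (fun _ => h) w := by
      ext i
      simp only [mv, shiftVec, Pi.add_apply, sg]
      split_ifs <;> ring
    rw [this, hfg' w _ (fun _ => ⟨h0.le, hh⟩)]
    rfl
  have hfin : (1 / h ^ l.length) * dfourier f v h c = (1 / 2 ^ d) * GG x g' v l c t := by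
    rw [hdf, he]
    field_simp
  rw [hfin]
  apply hρη (y := fun w => mv x c t w)
  rw [dist_pi_lt_iff hρ]
  intro w
  exact lt_of_lt_of_le (mv_mem x c t w ε hε hc
    fun b => ⟨(ht b).1.le, (ht b).2.trans_lt hh⟩) hερ

/-- Let `f` be smooth on simplices, `x ∈ (0,1)^d` an interior point,
`v ∈ {0,1}^d` and `α := α(d(x),v)` (the number of blocks of the coincidence partition of `x`
meeting the support of `v`, i.e. the number of distinct values `x` takes on the support of
`v`).  Then the generalised differential `D_α^v f(x)` exists and
`lim_{n→∞} (2n)^α Δ̃_n^v f(x) = D_α^v f(x)`. -/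
theorem statement5 {d : ℕ} (f : (Fin d → ℝ) → ℝ) (hf : SmoothOnSimplices f)
    (x : Fin d → ℝ) (hx : x ∈ cubeIoo d) (v : Fin d → Bool) :
    ∃ D : ℝ, HasGenDeriv f v (Set.ncard (x '' {i | v i = true})) x D ∧
      Tendsto (fun n : ℕ =>
          ((2 * n : ℕ) : ℝ) ^ (Set.ncard (x '' {i | v i = true})) * latticeDelta n f v x)
        atTop (nhds D) := by
  obtain ⟨D, hD⟩ := main_lim f hf x hx v
  refine ⟨D, ?_, ?_⟩
  · rw [HasGenDeriv, Metric.tendsto_nhds]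
    intro δ hδ
    obtain ⟨ε, hε, H⟩ := hD δ hδ
    filter_upwards [Ioo_mem_nhdsGT hε] with h hh
    exact H x h hh.1 hh.2 (by simpa using hε) (fun i j hij => hij)
  · rw [Metric.tendsto_nhds]
    intro δ hδ
    obtain ⟨ε, hε, H⟩ := hD δ hδ
    obtain ⟨N, hN⟩ := exists_nat_gt (1 / ε)
    filter_upwards [eventually_ge_atTop (N + 1)] with n hn
    have hn1 : (N : ℝ) + 1 ≤ n := by exact_mod_cast hn
    have hn0 : (0 : ℝ) < n := by
      have : (0 : ℝ) ≤ N := N.cast_nonneg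
      linarith
    have hne : 1 / (n : ℝ) < ε := by
      rw [div_lt_iff₀ hn0]
      rw [div_lt_iff₀ hε] at hN
      nlinarith
    have h2 : 1 / (2 * (n : ℝ)) = (1 / n) / 2 := by field_simp
    have hp : 0 < 1 / (n : ℝ) := by positivity
    have key := H (latticeCenter n x) (1 / (2 * n)) (by positivity) (by rw [h2]; linarith)
      (by
        rw [pi_norm_lt_iff hε]
        intro i
        have e1 := Int.floor_le ((n : ℝ) * x i)
        have e2 := Int.lt_floor_add_one ((n : ℝ) * x i)
        have e3 : (⌊(n : ℝ) * x i⌋ : ℝ) / n ≤ x i := by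
          rw [div_le_iff₀ hn0]; linarith
        have e4 : x i ≤ (⌊(n : ℝ) * x i⌋ : ℝ) / n + 1 / n := by
          rw [← add_div, le_div_iff₀ hn0]; linarith
        rw [Real.norm_eq_abs, abs_lt]
        simp only [latticeCenter, Pi.sub_apply]
        rw [h2]
        constructor <;> linarith)
      (fun i j hij => by simp only [latticeCenter, hij])
    rw [Real.dist_eq]
    convert key using 3
    rw [latticeDelta]
    congr 1
    rw [one_div_pow, one_div_one_div]
    push_cast
    rfl

end Paper
end

section
/- Let f : [0,1]^d → ℝ be smooth on simplices, let v ∈ {0,1}^d, and let 𝒫 be a partition of {1,…,d}. Then there exists a constant C such that for all n ∈ ℕ and all x ∈ [0,1)^d with d(x̃^{(n)}) = 𝒫 one has (2n)^{α(𝒫,v)} · |Δ̃_n^v f(x)| ≤ C; i.e. the rescaled lattice approximations of the derivative are uniformly bounded on the pixelated diagonal of type 𝒫. -/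
open MeasureTheory Filter Set

namespace Paper

variable {d : ℕ}

/-- iterated differences -/
def diffs {E F : Type} [AddCommGroup E] [AddCommGroup F] (g : E → F) : List E → E → F
  | [], x => g x
  | u :: us, x => diffs g us (x + u) - diffs g us x

/-- the box spanned by the directions at `x` is contained in `K` -/
def BoxIn {E : Type} [AddCommGroup E] [Module ℝ E] (K : Set E) : List E → E → Prop
  | [], x => x ∈ K
  | u :: us, x => ∀ t : ℝ, 0 ≤ t → t ≤ 1 → BoxIn K us (x + t • u)

theorem BoxIn.left {E : Type} [AddCommGroup E] [Module ℝ E] {K : Set E} {u : E} {us : List E}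
    {x : E} (h : BoxIn K (u :: us) x) : BoxIn K us x := by
  have := h 0 le_rfl zero_le_one
  simpa using this

theorem BoxIn.right {E : Type} [AddCommGroup E] [Module ℝ E] {K : Set E} {u : E} {us : List E}
    {x : E} (h : BoxIn K (u :: us) x) : BoxIn K us (x + u) := by
  have := h 1 zero_le_one le_rfl
  simpa using this

theorem diffs_congr {E F : Type} [AddCommGroup E] [Module ℝ E] [AddCommGroup F] {K : Set E}
    {f g : E → F} (hfg : Set.EqOn f g K) (us : List E) :
    ∀ x, BoxIn K us x → diffs f us x = diffs g us x := by
  induction us with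
  | nil => intro x hx; exact hfg hx
  | cons u us ih => intro x hx; simp only [diffs]; rw [ih _ hx.left, ih _ hx.right]

theorem hasFDerivAt_diffs {E F : Type} [NormedAddCommGroup E] [NormedSpace ℝ E]
    [NormedAddCommGroup F] [NormedSpace ℝ F] {K : Set E} {g : E → F}
    (hg : ∀ x ∈ K, DifferentiableAt ℝ g x) (us : List E) :
    ∀ x, BoxIn K us x → HasFDerivAt (diffs g us) (diffs (fderiv ℝ g) us x) x := by
  induction us with
  | nil => intro x hx; exact (hg x hx).hasFDerivAt
  | cons u us ih =>
    intro x hx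
    have h1 := ih _ hx.left
    have h2 := ih _ hx.right
    have h3 : HasFDerivAt (fun y => diffs g us (y + u)) (diffs (fderiv ℝ g) us (x + u)) x :=
      (hasFDerivAt_comp_add_right u).2 h2
    exact h3.sub h1

theorem diffs_bound {E : Type} [NormedAddCommGroup E] [NormedSpace ℝ E] {K U : Set E}
    (hK : IsCompact K) (hU : IsOpen U) (hKU : K ⊆ U) (m : ℕ) :
    ∀ (F : Type) [NormedAddCommGroup F] [NormedSpace ℝ F] (g : E → F),
      ContDiffOn ℝ (⊤ : ℕ∞) g U →
      ∃ C : ℝ, 0 ≤ C ∧ ∀ (h : ℝ), ∀ us : List E, us.length = m → (∀ u ∈ us, ‖u‖ ≤ h) →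
        ∀ x, BoxIn K us x → ‖diffs g us x‖ ≤ C * h ^ m := by
  induction m with
  | zero =>
    intro F _ _ g hg
    obtain ⟨C, hC⟩ := hK.exists_bound_of_continuousOn (hg.continuousOn.mono hKU)
    refine ⟨max C 0, le_max_right _ _, ?_⟩
    intro h us hus _ x hx
    obtain rfl := List.length_eq_zero_iff.mp hus
    simpa [diffs] using (Or.inl (hC x hx) : ‖g x‖ ≤ C ∨ ‖g x‖ ≤ 0)
  | succ m ih =>
    intro F _ _ g hg
    have hd : ContDiffOn ℝ (⊤ : ℕ∞) (fderiv ℝ g) U := hg.fderiv_of_isOpen hU (by simp)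
    obtain ⟨C, hC0, hC⟩ := ih (E →L[ℝ] F) (fderiv ℝ g) hd
    refine ⟨C, hC0, ?_⟩
    intro h us hus hn x hx
    cases us with
    | nil => simp at hus
    | cons u us =>
      have hdiff : ∀ x ∈ K, DifferentiableAt ℝ g x := fun x hx =>
        (hg.contDiffAt (hU.mem_nhds (hKU hx))).differentiableAt (by simp)
      have hu : ‖u‖ ≤ h := hn u (by simp)
      have hh : 0 ≤ h := (norm_nonneg _).trans hu
      have key := norm_image_sub_le_of_norm_deriv_le_segment_01'
        (f := fun t : ℝ => diffs g us (x + t • u))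
        (f' := fun t : ℝ => diffs (fderiv ℝ g) us (x + t • u) u)
        (C := C * h ^ (m + 1)) ?_ ?_
      · simpa [diffs] using key
      · intro t ht
        have h1 := hasFDerivAt_diffs hdiff us (x + t • u) (hx t ht.1 ht.2)
        have h2 : HasDerivAt (fun t : ℝ => x + t • u) u t := by
          simpa using ((hasDerivAt_id t).smul_const u).const_add x
        exact (h1.comp_hasDerivAt t h2).hasDerivWithinAt
      · intro t ht
        refine (ContinuousLinearMap.le_opNorm _ _).trans ?_
        have h3 := hC h us (by simpa using hus) (fun u' hu' => hn u' (by simp [hu'])) _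
          (hx t ht.1 ht.2.le)
        rw [pow_succ, ← mul_assoc]
        exact mul_le_mul h3 hu (norm_nonneg _) (by positivity)

/-- the point with block parameters `t` -/
def pt {k : ℕ} (p : Fin d → Fin k) (c : Fin d → ℝ) (h : ℝ) (w : Fin d → Bool) (t : Fin k → ℝ) :
    Fin d → ℝ := fun i => c i + t (p i) * shiftVec h w i

/-- direction of block `b` -/
def dirB {k : ℕ} (p : Fin d → Fin k) (h : ℝ) (w : Fin d → Bool) (b : Fin k) :
    Fin d → ℝ := fun i => if p i = b then shiftVec h w i else 0

/-- flip index `i` -/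
def flipAt (i : Fin d) (w : Fin d → Bool) : Fin d → Bool := Function.update w i (!(w i))

theorem flipAt_flipAt (i : Fin d) (w : Fin d → Bool) : flipAt i (flipAt i w) = w := by
  ext j
  by_cases h : j = i
  · subst h; simp [flipAt]
  · simp [flipAt, h]

theorem sgn_eq_prod (v w : Fin d → Bool) :
    sgn v w = ∏ i, (if v i = true ∧ w i = true then (-1 : ℝ) else 1) := by
  unfold sgn
  rw [Finset.prod_ite]; simp

theorem sgn_flipAt (v w : Fin d → Bool) (i : Fin d) (hi : v i = true) :
    sgn v (flipAt i w) = - sgn v w := by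
  rw [sgn_eq_prod, sgn_eq_prod, ← Finset.mul_prod_erase _ _ (Finset.mem_univ i),
    ← Finset.mul_prod_erase _ (fun i => if v i = true ∧ w i = true then (-1 : ℝ) else 1)
      (Finset.mem_univ i)]
  have : ∀ j ∈ Finset.univ.erase i, (if v j = true ∧ flipAt i w j = true then (-1 : ℝ) else 1)
      = (if v j = true ∧ w j = true then (-1 : ℝ) else 1) := by
    intro j hj
    simp [flipAt, Finset.ne_of_mem_erase hj]
  rw [Finset.prod_congr rfl this]
  cases hw : w i <;> simp [flipAt, hi, hw]

theorem sum_sgn_zero (v : Fin d → Bool) (i : Fin d) (hi : v i = true)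
    (φ : (Fin d → Bool) → ℝ) (hφ : ∀ w, φ (flipAt i w) = φ w) :
    ∑ w, sgn v w * φ w = 0 := by
  have h : ∑ w, sgn v w * φ w = ∑ w, sgn v (flipAt i w) * φ (flipAt i w) :=
    (Equiv.sum_comp ⟨flipAt i, flipAt i, flipAt_flipAt i, flipAt_flipAt i⟩
      (fun w => sgn v w * φ w)).symm
  have h2 : ∑ w, sgn v (flipAt i w) * φ (flipAt i w) = - ∑ w, sgn v w * φ w := by
    rw [← Finset.sum_neg_distrib]
    refine Finset.sum_congr rfl fun w _ => ?_
    rw [sgn_flipAt v w i hi, hφ]; ring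
  linarith

theorem shiftVec_flipAt (h : ℝ) (i j : Fin d) (w : Fin d → Bool) (hij : j ≠ i) :
    shiftVec h (flipAt i w) j = shiftVec h w j := by
  simp [shiftVec, flipAt, hij]

theorem pt_add {k : ℕ} (p : Fin d → Fin k) (c : Fin d → ℝ) (h : ℝ) (w : Fin d → Bool)
    (t : Fin k → ℝ) (b : Fin k) (hb : t b = 0) (τ : ℝ) :
    pt p c h w t + τ • dirB p h w b = pt p c h w (Function.update t b τ) := by
  ext i
  by_cases hi : p i = b
  · simp [pt, dirB, hi, hb]
  · simp [pt, dirB, hi]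

theorem sum_diffs {k : ℕ} (p : Fin d → Fin k) (c : Fin d → ℝ) (h : ℝ) (v : Fin d → Bool)
    (f : (Fin d → ℝ) → ℝ) (L : List (Fin k)) :
    ∀ t : Fin k → ℝ, L.Nodup → (∀ b ∈ L, ∃ i, p i = b ∧ v i = true) → (∀ b ∈ L, t b = 0) →
    ∑ w, sgn v w * diffs f (L.map (dirB p h w)) (pt p c h w t)
      = ∑ w, sgn v w * f (pt p c h w (fun b => if b ∈ L then 1 else t b)) := by
  induction L with
  | nil => intro t _ _ _; simp [diffs]
  | cons b L ih =>
    intro t hnd hact ht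
    obtain ⟨hbL, hnd'⟩ := List.nodup_cons.mp hnd
    have htb : t b = 0 := ht b (by simp)
    obtain ⟨i, hib, hvi⟩ := hact b (by simp)
    have hz : ∑ w, sgn v w * diffs f (L.map (dirB p h w)) (pt p c h w t) = 0 := by
      refine sum_sgn_zero v i hvi _ fun w => ?_
      have h1 : pt p c h (flipAt i w) t = pt p c h w t := by
        ext j
        by_cases hj : j = i
        · subst hj; simp [pt, hib, htb]
        · simp [pt, shiftVec_flipAt h i j w hj]
      have h2 : L.map (dirB p h (flipAt i w)) = L.map (dirB p h w) := by
        refine List.map_congr_left fun b' hb' => ?_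
        ext j
        by_cases hj : j = i
        · subst hj
          have : p j ≠ b' := by rw [hib]; rintro rfl; exact hbL hb'
          simp [dirB, this]
        · simp [dirB, shiftVec_flipAt h i j w hj]
      rw [h1, h2]
    have hstep : ∀ w, pt p c h w t + dirB p h w b = pt p c h w (Function.update t b 1) := by
      intro w; simpa using pt_add p c h w t b htb 1
    simp only [List.map_cons, diffs, mul_sub, Finset.sum_sub_distrib, hz, sub_zero, hstep]
    rw [ih (Function.update t b 1) hnd' (fun b' hb' => hact b' (by simp [hb'])) ?_]
    · refine Finset.sum_congr rfl fun w _ => ?_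
      congr 3
      funext b'
      by_cases hb' : b' = b
      · subst hb'; simp
      · simp [hb']
    · intro b' hb'
      have : b' ≠ b := by rintro rfl; exact hbL hb'
      simp [this, ht b' (by simp [hb'])]

theorem box_pt {k : ℕ} (p : Fin d → Fin k) (c : Fin d → ℝ) (h : ℝ) (w : Fin d → Bool)
    (K : Set (Fin d → ℝ)) (hK : ∀ t : Fin k → ℝ, (∀ b, 0 ≤ t b ∧ t b ≤ 1) → pt p c h w t ∈ K)
    (L : List (Fin k)) : ∀ t : Fin k → ℝ, L.Nodup → (∀ b ∈ L, t b = 0) →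
      (∀ b, 0 ≤ t b ∧ t b ≤ 1) → BoxIn K (L.map (dirB p h w)) (pt p c h w t) := by
  induction L with
  | nil => intro t _ _ ht; exact hK t ht
  | cons b L ih =>
    intro t hnd h0 ht
    obtain ⟨hbL, hnd'⟩ := List.nodup_cons.mp hnd
    intro τ hτ0 hτ1
    rw [pt_add p c h w t b (h0 b (by simp))]
    refine ih _ hnd' ?_ ?_
    · intro b' hb'
      have : b' ≠ b := by rintro rfl; exact hbL hb'
      simp [this, h0 b' (by simp [hb'])]
    · intro b'
      by_cases hb' : b' = b
      · subst hb'; simp [hτ0, hτ1]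
      · simpa [hb'] using ht b'

theorem abs_shiftVec (h : ℝ) (hh : 0 ≤ h) (w : Fin d → Bool) (i : Fin d) :
    |shiftVec h w i| = h := by
  unfold shiftVec; split_ifs <;> simp [abs_of_nonneg hh]

theorem exists_simplex {k : ℕ} (p : Fin d → Fin k) (c : Fin d → ℝ) (h : ℝ) (hh : 0 < h)
    (w : Fin d → Bool) (hc : ∀ i, h ≤ c i ∧ c i ≤ 1 - h) (hp : CoincWith c p)
    (hsep : ∀ i j, c i < c j → c i + 2 * h ≤ c j) :
    ∃ σ : Equiv.Perm (Fin d), ∀ t : Fin k → ℝ, (∀ b, 0 ≤ t b ∧ t b ≤ 1) →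
      pt p c h w t ∈ KuhnSimplex σ := by
  refine ⟨Tuple.sort (fun i => c i + shiftVec h w i / 2), ?_⟩
  intro t ht
  have hts : ∀ i, |t (p i) * shiftVec h w i| ≤ h := by
    intro i
    rw [abs_mul, abs_shiftVec h hh.le, abs_of_nonneg (ht _).1]
    nlinarith [(ht (p i)).2]
  have hs : ∀ i, |shiftVec h w i| ≤ h := fun i => (abs_shiftVec h hh.le w i).le
  refine ⟨⟨fun i => ?_, fun i => ?_⟩, ?_⟩
  · have := abs_le.mp (hts i)
    have := hc i
    simp only [pt, Pi.zero_apply]; linarith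
  · have := abs_le.mp (hts i)
    have := hc i
    simp only [pt, Pi.one_apply]; linarith
  · intro i j hij
    have hm := Tuple.monotone_sort (fun i => c i + shiftVec h w i / 2) hij
    simp only [Function.comp] at hm
    generalize Tuple.sort (fun i => c i + shiftVec h w i / 2) i = a at *
    generalize Tuple.sort (fun i => c i + shiftVec h w i / 2) j = b at *
    simp only [pt]
    by_cases hab : c a = c b
    · have hpab := (hp a b).mp hab
      rw [hpab, hab]
      have : shiftVec h w a ≤ shiftVec h w b := by linarith
      have := mul_le_mul_of_nonneg_left this (ht (p b)).1
      linarith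
    · have h1 := abs_le.mp (hs a)
      have h2 := abs_le.mp (hs b)
      have h3 := abs_le.mp (hts a)
      have h4 := abs_le.mp (hts b)
      rcases lt_or_gt_of_ne hab with hlt | hlt
      · have := hsep _ _ hlt; linarith
      · have := hsep _ _ hlt; linarith

theorem isCompact_Kuhn (σ : Equiv.Perm (Fin d)) : IsCompact (KuhnSimplex σ) := by
  have h1 : IsCompact (cubeIcc d) := isCompact_Icc
  have h2 : IsClosed {x : Fin d → ℝ | ∀ i j : Fin d, i ≤ j → x (σ i) ≤ x (σ j)} := by
    simp only [Set.ofPred_forall]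
    exact isClosed_iInter fun i => isClosed_iInter fun j => isClosed_iInter fun _ =>
      isClosed_le (continuous_apply _) (continuous_apply _)
  exact h1.inter_right h2

theorem abs_sgn (v w : Fin d → Bool) : |sgn v w| = 1 := by
  simp [sgn]

/-- Let `f` be smooth on simplices, `v ∈ {0,1}^d`, `𝒫` a partition of
`{1,…,d}` (encoded by a surjection `p : Fin d → Fin k` onto its blocks).  Then the rescaled
lattice approximations `(2n)^{α(𝒫,v)} Δ̃_n^v f` are uniformly bounded on the pixelated
diagonal `{x ∈ [0,1)^d : d(x̃^{(n)}) = 𝒫}`. -/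
theorem statement13 {d k : ℕ} (f : (Fin d → ℝ) → ℝ) (hf : SmoothOnSimplices f)
    (v : Fin d → Bool) (p : Fin d → Fin k) (hp : Function.Surjective p) :
    ∃ C : ℝ, ∀ n : ℕ, 0 < n → ∀ x ∈ cubeIco d, CoincWith (latticeCenter n x) p →
      ((2 * n : ℕ) : ℝ) ^ (alphaP p v) * |latticeDelta n f v x| ≤ C := by
  classical
  have hex : ∀ σ : Equiv.Perm (Fin d), ∃ C : ℝ, 0 ≤ C ∧ ∀ (h : ℝ), ∀ us : List (Fin d → ℝ),
      us.length = alphaP p v → (∀ u ∈ us, ‖u‖ ≤ h) → ∀ x, BoxIn (KuhnSimplex σ) us x →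
      |diffs f us x| ≤ C * h ^ (alphaP p v) := by
    intro σ
    obtain ⟨U, g, hU, hKU, hg, hfg⟩ := hf.2 σ
    obtain ⟨C, hC0, hC⟩ := diffs_bound (isCompact_Kuhn σ) hU hKU (alphaP p v) ℝ g hg
    refine ⟨C, hC0, fun h us hl hn x hx => ?_⟩
    rw [diffs_congr hfg us x hx]
    exact hC h us hl hn x hx
  choose C hC0 hC using hex
  refine ⟨∑ σ, C σ, ?_⟩
  intro n hn x hx hcw
  have hn' : (0 : ℝ) < n := by exact_mod_cast hn
  set c := latticeCenter n x with hcdef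
  set h : ℝ := 1 / (2 * n) with hhdef
  have hh : 0 < h := by positivity
  have hci : ∀ i, c i = 2 * h * (⌊(n : ℝ) * x i⌋ : ℝ) + h := by
    intro i
    simp only [hcdef, latticeCenter, hhdef]
    field_simp
  have h2n : 2 * h * n = 1 := by rw [hhdef]; field_simp
  have hc : ∀ i, h ≤ c i ∧ c i ≤ 1 - h := by
    intro i
    have hxi := hx i (Set.mem_univ i)
    have h0 : (0 : ℤ) ≤ ⌊(n : ℝ) * x i⌋ := Int.floor_nonneg.mpr (mul_nonneg hn'.le hxi.1)
    have h1 : ⌊(n : ℝ) * x i⌋ < (n : ℤ) := by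
      rw [Int.floor_lt]; push_cast; nlinarith [hxi.2]
    have h0' : (0 : ℝ) ≤ (⌊(n : ℝ) * x i⌋ : ℝ) := by exact_mod_cast h0
    have h1' : (⌊(n : ℝ) * x i⌋ : ℝ) + 1 ≤ n := by exact_mod_cast h1
    rw [hci]
    constructor
    · nlinarith
    · nlinarith
  have hsep : ∀ i j, c i < c j → c i + 2 * h ≤ c j := by
    intro i j hij
    rw [hci, hci] at hij ⊢
    have h1 : (⌊(n : ℝ) * x i⌋ : ℝ) < (⌊(n : ℝ) * x j⌋ : ℝ) := by
      by_contra hcon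
      push Not at hcon
      nlinarith
    have h2 : (⌊(n : ℝ) * x i⌋ : ℝ) + 1 ≤ (⌊(n : ℝ) * x j⌋ : ℝ) := by exact_mod_cast h1
    nlinarith
  set S := (Finset.univ.filter fun i => v i = true).image p with hS
  have hL : S.toList.length = alphaP p v := by rw [Finset.length_toList]; rfl
  let t : Fin k → ℝ := fun b => if b ∈ S then 0 else 1
  have hsum := sum_diffs p c h v f S.toList t (Finset.nodup_toList S)
    (by
      intro b hb
      rw [Finset.mem_toList, hS, Finset.mem_image] at hb
      obtain ⟨i, hi, hib⟩ := hb
      exact ⟨i, hib, by simpa using hi⟩)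
    (by
      intro b hb
      rw [Finset.mem_toList] at hb
      simp [t, hb])
  have hone : ∀ w, pt p c h w (fun b => if b ∈ S.toList then 1 else t b) = c + shiftVec h w := by
    intro w
    ext i
    by_cases hb : p i ∈ S <;> simp [pt, t, hb]
  simp only [hone] at hsum
  have hterm : ∀ w, |sgn v w * diffs f (S.toList.map (dirB p h w)) (pt p c h w t)|
      ≤ (∑ σ, C σ) * h ^ (alphaP p v) := by
    intro w
    rw [abs_mul, abs_sgn, one_mul]
    obtain ⟨σ, hσ⟩ := exists_simplex p c h hh w hc hcw hsep
    refine (hC σ h _ (by simpa using hL) ?_ _ (box_pt p c h w _ hσ S.toList t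
      (Finset.nodup_toList S) ?_ ?_)).trans ?_
    · intro u hu
      obtain ⟨b, _, rfl⟩ := List.mem_map.mp hu
      rw [pi_norm_le_iff_of_nonneg hh.le]
      intro i
      by_cases hb : p i = b
      · simp [dirB, hb, abs_shiftVec h hh.le]
      · simp [dirB, hb, hh.le]
    · intro b hb
      rw [Finset.mem_toList] at hb
      simp [t, hb]
    · intro b
      by_cases hb : b ∈ S <;> simp [t, hb]
    · exact mul_le_mul_of_nonneg_right
        (Finset.single_le_sum (fun σ _ => hC0 σ) (Finset.mem_univ σ)) (by positivity)
  have hD : |latticeDelta n f v x| ≤ (∑ σ, C σ) * h ^ (alphaP p v) := by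
    unfold latticeDelta dfourier
    rw [← hcdef, ← hhdef, ← hsum, abs_mul]
    have h1 := (Finset.abs_sum_le_sum_abs (fun w => sgn v w *
      diffs f (S.toList.map (dirB p h w)) (pt p c h w t)) Finset.univ).trans
      (Finset.sum_le_sum fun w _ => hterm w)
    rw [Finset.sum_const, Finset.card_univ, Fintype.card_fun, Fintype.card_bool, Fintype.card_fin,
      nsmul_eq_mul] at h1
    push_cast at h1
    rw [abs_of_pos (by positivity : (0 : ℝ) < 1 / 2 ^ d), one_div, inv_mul_le_iff₀ (by positivity)]
    exact h1
  calc ((2 * n : ℕ) : ℝ) ^ (alphaP p v) * |latticeDelta n f v x|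
      ≤ ((2 * n : ℕ) : ℝ) ^ (alphaP p v) * ((∑ σ, C σ) * h ^ (alphaP p v)) := by gcongr
    _ = (∑ σ, C σ) * (2 * h * n) ^ (alphaP p v) := by
        push_cast
        rw [show 2 * h * (n : ℝ) = (2 * n) * h by ring, mul_pow (2 * (n : ℝ)) h]; ring
    _ ≤ ∑ σ, C σ := by rw [h2n]; simp

end Paper
end
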